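/- arXiv:2410.08056 — 4 statements merged into one kernel-verified Lean document; each statement's English description precedes it below -/
import Mathlib

section
/- Let t ∈ [0,1) and let (f_n) be a sequence of bounded holomorphic functions on the unit disc 𝔻 with ‖f_n‖_∞ ≤ 1 for every n, such that f_n → 0 uniformly on every compact subset of 𝔻. Then ‖C_t f_n‖_∞ → 0 as n → ∞. -/
open Complex MeasureTheory Metric Set Filter Topology

/-- The generalized Cesàro operator `C_t`, given by
`(C_t f)(z) = ∫_0^1 f(sz)/(1 - s t z) ds`, which equals `f(0)` at `z = 0` and
`(1/z)∫_0^z f(ξ)/(1 - tξ) dξ` for `z ≠ 0`. -/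
noncomputable def cesaro (t : ℝ) (f : ℂ → ℂ) (z : ℂ) : ℂ :=
  ∫ s in (0:ℝ)..1, f ((s : ℂ) * z) / (1 - (s : ℂ) * (t : ℂ) * z)

/-- The sup norm `‖f‖_∞ = sup_{z ∈ 𝔻} |f z|`. -/
noncomputable def supNorm (f : ℂ → ℂ) : ℝ :=
  sSup ((fun z => ‖f z‖) '' Metric.ball (0:ℂ) 1)

/-- If `‖f‖ ≤ 1` on the unit disc and `‖f‖ ≤ ε` on the closed disc of radius `r`, then
`‖C_t f‖ ≤ (ε + (1 - r)) / (1 - t)` on the unit disc. -/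
theorem norm_cesaro_le {t : ℝ} (ht0 : 0 ≤ t) (ht1 : t < 1) {f : ℂ → ℂ}
    (hf : ContinuousOn f (Metric.ball (0:ℂ) 1))
    (hbdd : ∀ z ∈ Metric.ball (0:ℂ) 1, ‖f z‖ ≤ 1) {r ε : ℝ} (hr0 : 0 ≤ r) (hr1 : r ≤ 1)
    (hε : 0 ≤ ε) (hsmall : ∀ z ∈ Metric.closedBall (0:ℂ) r, ‖f z‖ ≤ ε)
    {z : ℂ} (hz : z ∈ Metric.ball (0:ℂ) 1) :
    ‖cesaro t f z‖ ≤ (ε + (1 - r)) / (1 - t) := by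
  have hz1 : ‖z‖ < 1 := by simpa using hz
  have ht : 0 < 1 - t := sub_pos.2 ht1
  have hnorm : ∀ s ∈ Icc (0:ℝ) 1, ‖(s:ℂ) * z‖ ≤ s ∧ (s:ℂ) * z ∈ Metric.ball (0:ℂ) 1 := by
    intro s hs
    have h : ‖(s:ℂ) * z‖ = s * ‖z‖ := by
      rw [norm_mul, Complex.norm_real, Real.norm_of_nonneg hs.1]
    rw [mem_ball_zero_iff, h]
    exact ⟨mul_le_of_le_one_right hs.1 hz1.le,
      (mul_le_of_le_one_left (norm_nonneg z) hs.2).trans_lt hz1⟩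
  have hden : ∀ s ∈ Icc (0:ℝ) 1, 1 - t ≤ ‖1 - (s:ℂ) * (t:ℂ) * z‖ := by
    intro s hs
    have h : ‖(s:ℂ) * (t:ℂ) * z‖ ≤ t := by
      rw [mul_right_comm, norm_mul, Complex.norm_real, Real.norm_of_nonneg ht0]
      exact mul_le_of_le_one_left ht0 ((hnorm s hs).1.trans hs.2)
    have h' := norm_sub_norm_le (1:ℂ) ((s:ℂ) * (t:ℂ) * z)
    rw [norm_one] at h'
    linarith
  have hcont : ContinuousOn
      (fun s : ℝ => f ((s:ℂ) * z) / (1 - (s:ℂ) * (t:ℂ) * z)) (Icc 0 1) := by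
    refine ContinuousOn.div (hf.comp (by fun_prop) fun s hs => (hnorm s hs).2) (by fun_prop) ?_
    intro s hs
    exact norm_pos_iff.1 (ht.trans_le (hden s hs))
  have hbound : ∀ s ∈ Icc (0:ℝ) 1, ∀ c : ℝ, 0 ≤ c → ‖f ((s:ℂ) * z)‖ ≤ c →
      ‖f ((s:ℂ) * z) / (1 - (s:ℂ) * (t:ℂ) * z)‖ ≤ c / (1 - t) := by
    intro s hs c hc h
    rw [norm_div]
    exact div_le_div₀ hc h ht (hden s hs)
  have hint₁ : IntervalIntegrable
      (fun s : ℝ => f ((s:ℂ) * z) / (1 - (s:ℂ) * (t:ℂ) * z)) volume 0 r :=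
    (hcont.mono (Icc_subset_Icc_right hr1)).intervalIntegrable_of_Icc hr0
  have hint₂ : IntervalIntegrable
      (fun s : ℝ => f ((s:ℂ) * z) / (1 - (s:ℂ) * (t:ℂ) * z)) volume r 1 :=
    (hcont.mono (Icc_subset_Icc_left hr0)).intervalIntegrable_of_Icc hr1
  have h₁ : ‖∫ s in (0:ℝ)..r, f ((s:ℂ) * z) / (1 - (s:ℂ) * (t:ℂ) * z)‖
      ≤ ε / (1 - t) * |r - 0| := by
    refine intervalIntegral.norm_integral_le_of_norm_le_const fun s hs => ?_
    rw [uIoc_of_le hr0] at hs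
    have hs' : s ∈ Icc (0:ℝ) 1 := ⟨hs.1.le, hs.2.trans hr1⟩
    exact hbound s hs' ε hε
      (hsmall _ (mem_closedBall_zero_iff.2 ((hnorm s hs').1.trans hs.2)))
  have h₂ : ‖∫ s in r..(1:ℝ), f ((s:ℂ) * z) / (1 - (s:ℂ) * (t:ℂ) * z)‖
      ≤ 1 / (1 - t) * |1 - r| := by
    refine intervalIntegral.norm_integral_le_of_norm_le_const fun s hs => ?_
    rw [uIoc_of_le hr1] at hs
    have hs' : s ∈ Icc (0:ℝ) 1 := ⟨hr0.trans hs.1.le, hs.2⟩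
    exact hbound s hs' 1 zero_le_one (hbdd _ (hnorm s hs').2)
  rw [sub_zero, abs_of_nonneg hr0] at h₁
  rw [abs_of_nonneg (sub_nonneg.2 hr1)] at h₂
  have h₃ : ε / (1 - t) * r ≤ ε / (1 - t) :=
    mul_le_of_le_one_right (div_nonneg hε ht.le) hr1
  rw [cesaro, ← intervalIntegral.integral_add_adjacent_intervals hint₁ hint₂]
  calc _ ≤ _ := norm_add_le _ _
    _ ≤ ε / (1 - t) + 1 / (1 - t) * (1 - r) := add_le_add (h₁.trans h₃) h₂
    _ = (ε + (1 - r)) / (1 - t) := by ring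

theorem supNorm_nonneg (f : ℂ → ℂ) : 0 ≤ supNorm f := by
  refine Real.sSup_nonneg ?_
  rintro _ ⟨z, -, rfl⟩
  exact norm_nonneg _

theorem supNorm_le {f : ℂ → ℂ} {c : ℝ} (h : ∀ z ∈ Metric.ball (0:ℂ) 1, ‖f z‖ ≤ c) :
    supNorm f ≤ c := by
  refine csSup_le ((nonempty_ball.2 one_pos).image _) ?_
  rintro _ ⟨z, hz, rfl⟩
  exact h z hz

/-- If `(f_n) ⊆ H^∞` satisfies `‖f_n‖_∞ ≤ 1` for all `n` and `f_n → 0` uniformly on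
every compact subset of the unit disc, then `‖C_t f_n‖_∞ → 0`, for each `t ∈ [0,1)`. -/
theorem cesaro_tendsto_zero_of_compact_convergence (t : ℝ) (ht0 : 0 ≤ t) (ht1 : t < 1)
    (f : ℕ → ℂ → ℂ)
    (hholo : ∀ n, DifferentiableOn ℂ (f n) (Metric.ball (0:ℂ) 1))
    (hbdd : ∀ n, ∀ z ∈ Metric.ball (0:ℂ) 1, ‖f n z‖ ≤ 1)
    (hconv : ∀ K ⊆ Metric.ball (0:ℂ) 1, IsCompact K →
      TendstoUniformlyOn (fun n z => f n z) 0 atTop K) :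
    Tendsto (fun n => supNorm (cesaro t (f n))) atTop (𝓝 0) := by
  rw [Metric.tendsto_atTop]
  intro ε hε
  have ht : 0 < 1 - t := sub_pos.2 ht1
  obtain ⟨δ, hδ0, hδ⟩ : ∃ δ : ℝ, 0 < δ ∧ δ < min 1 (ε * (1 - t) / 2) :=
    exists_between (lt_min one_pos (by positivity))
  obtain ⟨hδ1, hδε⟩ := lt_min_iff.1 hδ
  have hev := Metric.tendstoUniformlyOn_iff.1 (hconv (Metric.closedBall 0 (1 - δ))
    (closedBall_subset_ball (by linarith)) (isCompact_closedBall _ _)) δ hδ0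
  obtain ⟨N, hN⟩ := eventually_atTop.1 hev
  refine ⟨N, fun n hn => ?_⟩
  rw [Real.dist_0_eq_abs, abs_of_nonneg (supNorm_nonneg _)]
  have hle : supNorm (cesaro t (f n)) ≤ (δ + (1 - (1 - δ))) / (1 - t) :=
    supNorm_le fun z hz => norm_cesaro_le ht0 ht1 (hholo n).continuousOn (hbdd n)
      (by linarith) (by linarith) hδ0.le
      (fun w hw => by simpa using (hN n hn w hw).le) hz
  refine hle.trans_lt ?_
  rw [div_lt_iff₀ ht]
  linarith
end

section
/- For every t ∈ [0,1), the point spectrum of C_t acting on H^∞ and the point spectrum of C_t acting on A(𝔻) both equal {1/(m+1) : m ∈ ℕ₀}, i.e., λ ∈ ℂ is an eigenvalue of C_t on either space if and only if λ = 1/(m+1) for some integer m ≥ 0. -/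
open Complex MeasureTheory Metric Set Filter Topology

/-- Membership in `H^∞`: holomorphic and bounded on the open unit disc. -/
def MemHinf (f : ℂ → ℂ) : Prop :=
  DifferentiableOn ℂ f (Metric.ball (0:ℂ) 1) ∧
    BddAbove ((fun z => ‖f z‖) '' Metric.ball (0:ℂ) 1)

/-- Membership in the disc algebra `A(𝔻)`: holomorphic on the open unit disc and
continuous on the closed unit disc (i.e. extends continuously to the closed disc). -/
def MemDiscAlg (f : ℂ → ℂ) : Prop :=
  DifferentiableOn ℂ f (Metric.ball (0:ℂ) 1) ∧ ContinuousOn f (Metric.closedBall (0:ℂ) 1)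

theorem one_sub_mul_ne_zero {t : ℝ} (ht0 : 0 ≤ t) (ht1 : t < 1) {s : ℝ} (hs : s ∈ Set.Icc (0:ℝ) 1)
    {z : ℂ} (hz : ‖z‖ ≤ 1) : 1 - (s : ℂ) * (t : ℂ) * z ≠ 0 := by
  intro h
  have h1 : ‖(s : ℂ) * (t : ℂ) * z‖ = 1 := by rw [← sub_eq_zero.1 h, norm_one]
  rw [norm_mul, norm_mul, Complex.norm_of_nonneg hs.1, Complex.norm_of_nonneg ht0] at h1
  have h2 : s * t ≤ t := mul_le_of_le_one_left ht0 hs.2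
  have h3 : s * t * ‖z‖ ≤ s * t := mul_le_of_le_one_right (mul_nonneg hs.1 ht0) hz
  linarith

theorem MemDiscAlg.memHinf {f : ℂ → ℂ} (hf : MemDiscAlg f) : MemHinf f :=
  ⟨hf.1, ((isCompact_closedBall (0:ℂ) 1).bddAbove_image hf.2.norm).mono
    (Set.image_mono Metric.ball_subset_closedBall)⟩

/-- The eigenfunction `z ^ m / (1 - t z) ^ (m + 1)` of `C_t`. -/
noncomputable def cesaroEigenfunction (t : ℝ) (m : ℕ) (z : ℂ) : ℂ :=
  z ^ m / (1 - (t : ℂ) * z) ^ (m + 1)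

theorem memDiscAlg_cesaroEigenfunction {t : ℝ} (ht0 : 0 ≤ t) (ht1 : t < 1) (m : ℕ) :
    MemDiscAlg (cesaroEigenfunction t m) := by
  have hd : DifferentiableOn ℂ (cesaroEigenfunction t m) (Metric.closedBall (0:ℂ) 1) := by
    intro z hz
    have h := one_sub_mul_ne_zero ht0 ht1 (s := 1) (by simp) (mem_closedBall_zero_iff.1 hz)
    rw [Complex.ofReal_one, one_mul] at h
    unfold cesaroEigenfunction
    exact DifferentiableWithinAt.div (by fun_prop) (by fun_prop) (pow_ne_zero _ h)
  exact ⟨hd.mono Metric.ball_subset_closedBall, hd.continuousOn⟩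

theorem cesaro_cesaroEigenfunction {t : ℝ} (ht0 : 0 ≤ t) (ht1 : t < 1) (m : ℕ) {z : ℂ}
    (hz : ‖z‖ ≤ 1) :
    cesaro t (cesaroEigenfunction t m) z = 1 / ((m : ℂ) + 1) * cesaroEigenfunction t m z := by
  have hm : (m : ℂ) + 1 ≠ 0 := Nat.cast_add_one_ne_zero m
  have hne : ∀ s ∈ Set.uIcc (0:ℝ) 1, 1 - (s : ℂ) * (t : ℂ) * z ≠ 0 := fun s hs =>
    one_sub_mul_ne_zero ht0 ht1 (by rwa [Set.uIcc_of_le zero_le_one] at hs) hz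
  have hrw : ∀ s : ℝ, (1 - (t : ℂ) * ((s : ℂ) * z)) = 1 - (s : ℂ) * (t : ℂ) * z := fun s => by ring
  have key := intervalIntegral.integral_eq_sub_of_hasDerivAt (a := (0:ℝ)) (b := 1)
    (f := fun s : ℝ => z ^ m / ((m : ℂ) + 1) *
      ((s : ℂ) ^ (m + 1) / (1 - (s : ℂ) * (t : ℂ) * z) ^ (m + 1)))
    (f' := fun s : ℝ => cesaroEigenfunction t m ((s : ℂ) * z) / (1 - (s : ℂ) * (t : ℂ) * z))
    (fun s hs => by
      have h0 : HasDerivAt (fun s : ℝ => (s : ℂ)) 1 s := Complex.ofRealCLM.hasDerivAt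
      have h1 := (h0.mul_const (t : ℂ)).mul_const z |>.const_sub 1
      have h2 := ((h0.pow (m + 1)).div (h1.pow (m + 1)) (pow_ne_zero _ (hne s hs))).const_mul
        (z ^ m / ((m : ℂ) + 1))
      refine h2.congr_deriv ?_
      have := hne s hs
      simp only [cesaroEigenfunction, hrw, Pi.pow_apply]
      push_cast
      field_simp
      ring)
    (ContinuousOn.intervalIntegrable (by
      simp only [cesaroEigenfunction, hrw]
      exact ContinuousOn.div (ContinuousOn.div (by fun_prop) (by fun_prop)
        fun s hs => pow_ne_zero _ (hne s hs)) (by fun_prop) hne))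
  rw [cesaro, key]
  simp only [cesaroEigenfunction, Complex.ofReal_one, Complex.ofReal_zero, one_pow, one_mul]
  simp
  ring

theorem tendsto_integral_pow_mul_comp_mul {k : ℂ → ℂ} {r : ℝ} (hr : 0 < r)
    (hk : ContinuousOn k (Metric.closedBall 0 r)) (m : ℕ) :
    Tendsto (fun z : ℂ => ∫ s in (0:ℝ)..1, (s : ℂ) ^ m * k ((s : ℂ) * z)) (𝓝 0)
      (𝓝 (1 / ((m : ℂ) + 1) * k 0)) := by
  have hmem : ∀ s ∈ Set.Icc (0:ℝ) 1, ∀ z ∈ Metric.closedBall (0:ℂ) r,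
      (s : ℂ) * z ∈ Metric.closedBall (0:ℂ) r := by
    intro s hs z hz
    rw [mem_closedBall_zero_iff] at hz ⊢
    rw [norm_mul, Complex.norm_of_nonneg hs.1]
    exact (mul_le_of_le_one_left (norm_nonneg _) hs.2).trans hz
  obtain ⟨M, hM⟩ := (isCompact_closedBall (0:ℂ) r).exists_bound_of_continuousOn hk
  have hlim : ∫ s in (0:ℝ)..1, (s : ℂ) ^ m * k 0 = 1 / ((m : ℂ) + 1) * k 0 := by
    rw [intervalIntegral.integral_mul_const]
    congr 1
    have h := integral_pow (a := 0) (b := 1) m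
    have h' : ∫ s in (0:ℝ)..1, (s : ℂ) ^ m = ((∫ s in (0:ℝ)..1, s ^ m : ℝ) : ℂ) := by
      rw [← intervalIntegral.integral_ofReal]
      simp
    rw [h', h]
    simp
  rw [← hlim]
  refine intervalIntegral.tendsto_integral_filter_of_dominated_convergence (fun _ => M) ?_ ?_
    intervalIntegrable_const ?_
  · filter_upwards [Metric.closedBall_mem_nhds (0:ℂ) hr] with z hz
    refine (ContinuousOn.mono (s := Set.Icc 0 1) ?_ ?_).aestronglyMeasurable measurableSet_uIoc
    · exact ContinuousOn.mul (by fun_prop)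
        (hk.comp (by fun_prop) fun s hs => hmem s hs z hz)
    · rw [Set.uIoc_of_le zero_le_one]
      exact Set.Ioc_subset_Icc_self
  · filter_upwards [Metric.closedBall_mem_nhds (0:ℂ) hr] with z hz
    refine Eventually.of_forall fun s hs => ?_
    rw [Set.uIoc_of_le zero_le_one] at hs
    have hs' := Set.Ioc_subset_Icc_self hs
    rw [norm_mul, norm_pow, Complex.norm_of_nonneg hs'.1]
    exact (mul_le_of_le_one_left (norm_nonneg _) (pow_le_one₀ hs'.1 hs'.2)).trans
      (hM _ (hmem s hs' z hz))
  · refine Eventually.of_forall fun s _ => ?_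
    have h0 : ContinuousAt k ((s : ℂ) * 0) := by
      rw [mul_zero]
      exact hk.continuousAt (Metric.closedBall_mem_nhds (0:ℂ) hr)
    have h1 : ContinuousAt (fun z : ℂ => k ((s : ℂ) * z)) 0 :=
      ContinuousAt.comp (f := fun z : ℂ => (s : ℂ) * z) h0 (by fun_prop)
    have h2 := h1.tendsto.const_mul ((s : ℂ) ^ m)
    rwa [mul_zero] at h2

theorem eigenvalue_eq_of_eqOn_cesaro {t : ℝ} (ht0 : 0 ≤ t) (ht1 : t < 1) {lam : ℂ} {f : ℂ → ℂ}
    (hf : DifferentiableOn ℂ f (Metric.ball (0:ℂ) 1)) (hne : ∃ z ∈ Metric.ball (0:ℂ) 1, f z ≠ 0)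
    (heq : Set.EqOn (cesaro t f) (fun z => lam * f z) (Metric.ball (0:ℂ) 1)) :
    ∃ m : ℕ, lam = 1 / ((m : ℂ) + 1) := by
  have han : AnalyticOnNhd ℂ f (Metric.ball (0:ℂ) 1) := hf.analyticOnNhd Metric.isOpen_ball
  have h0 : (0:ℂ) ∈ Metric.ball (0:ℂ) 1 := Metric.mem_ball_self one_pos
  have hnz : ¬ ∀ᶠ z in 𝓝 (0:ℂ), f z = 0 := by
    intro h
    obtain ⟨z, hz, hfz⟩ := hne
    exact hfz (han.eqOn_zero_of_preconnected_of_eventuallyEq_zero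
      (convex_ball (0:ℂ) 1).isPreconnected h0 h hz)
  obtain ⟨m, h, hh, hh0, hfh⟩ := (han 0 h0).exists_eventuallyEq_pow_smul_nonzero_iff.2 hnz
  refine ⟨m, ?_⟩
  obtain ⟨r, hr, hball⟩ := Metric.eventually_nhds_iff_ball.1
    (hfh.and (hh.eventually_analyticAt.and (Metric.ball_mem_nhds (0:ℂ) one_pos)))
  simp only [sub_zero, smul_eq_mul] at hball
  have hsub : Metric.closedBall (0:ℂ) (r / 2) ⊆ Metric.ball 0 r :=
    Metric.closedBall_subset_ball (by linarith)
  have hk : ContinuousOn (fun z => h z / (1 - (t : ℂ) * z)) (Metric.closedBall 0 (r / 2)) := by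
    intro z hz
    have hb := hball z (hsub hz)
    have hd := one_sub_mul_ne_zero ht0 ht1 (s := 1) (by simp) (mem_ball_zero_iff.1 hb.2.2).le
    rw [Complex.ofReal_one, one_mul] at hd
    exact hb.2.1.continuousAt.continuousWithinAt.div (by fun_prop) hd
  have hlim := (tendsto_integral_pow_mul_comp_mul (half_pos hr) hk m).mono_left
    (nhdsWithin_le_nhds (s := {0}ᶜ))
  have hlim' : Tendsto (fun z => lam * h z) (𝓝[≠] 0) (𝓝 (lam * h 0)) :=
    (hh.continuousAt.tendsto.const_mul lam).mono_left nhdsWithin_le_nhds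
  have hcongr : (fun z : ℂ => ∫ s in (0:ℝ)..1,
      (s : ℂ) ^ m * (h ((s : ℂ) * z) / (1 - (t : ℂ) * ((s : ℂ) * z)))) =ᶠ[𝓝[≠] 0]
      fun z => lam * h z := by
    filter_upwards [self_mem_nhdsWithin, nhdsWithin_le_nhds (Metric.ball_mem_nhds (0:ℂ) hr)]
      with z hz0 hz
    have hz0 : z ≠ 0 := hz0
    have hb := hball z hz
    have he := heq hb.2.2
    refine mul_left_cancel₀ (pow_ne_zero m hz0) ?_
    calc _ = cesaro t f z := by
          rw [cesaro, ← intervalIntegral.integral_const_mul]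
          refine intervalIntegral.integral_congr fun s hs => ?_
          rw [Set.uIcc_of_le zero_le_one] at hs
          have hsz : (s : ℂ) * z ∈ Metric.ball (0:ℂ) r := by
            rw [mem_ball_zero_iff] at hz ⊢
            rw [norm_mul, Complex.norm_of_nonneg hs.1]
            exact (mul_le_of_le_one_left (norm_nonneg _) hs.2).trans_lt hz
          simp only [(hball _ hsz).1]
          ring
      _ = lam * f z := he
      _ = _ := by rw [hb.1]; ring
  have := tendsto_nhds_unique (hlim.congr' hcongr) hlim'
  simp only [mul_zero, sub_zero, div_one] at this
  exact (mul_right_cancel₀ hh0 this).symm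

theorem exists_memDiscAlg_eigenfunction {t : ℝ} (ht0 : 0 ≤ t) (ht1 : t < 1) (m : ℕ) :
    ∃ f, MemDiscAlg f ∧ (∃ z ∈ Metric.ball (0:ℂ) 1, f z ≠ 0) ∧
      Set.EqOn (cesaro t f) (fun z => 1 / ((m : ℂ) + 1) * f z) (Metric.ball (0:ℂ) 1) := by
  refine ⟨cesaroEigenfunction t m, memDiscAlg_cesaroEigenfunction ht0 ht1 m, ⟨1 / 2, ?_, ?_⟩,
    fun z hz => cesaro_cesaroEigenfunction ht0 ht1 m (mem_ball_zero_iff.1 hz).le⟩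
  · rw [mem_ball_zero_iff]
    norm_num
  · have h := one_sub_mul_ne_zero ht0 ht1 (s := 1) (by simp) (z := 1 / 2) (by norm_num)
    rw [Complex.ofReal_one, one_mul] at h
    exact div_ne_zero (pow_ne_zero _ (by norm_num)) (pow_ne_zero _ h)

/-- For each `t ∈ [0,1)`, a complex number `λ` is an eigenvalue of `C_t` on `H^∞`
(respectively on `A(𝔻)`) if and only if `λ = 1/(m+1)` for some `m ∈ ℕ₀`. -/
theorem cesaro_point_spectrum_Hinf_discAlg (t : ℝ) (ht0 : 0 ≤ t) (ht1 : t < 1) (lam : ℂ) :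
    ((∃ f, MemHinf f ∧ (∃ z ∈ Metric.ball (0:ℂ) 1, f z ≠ 0) ∧
        Set.EqOn (cesaro t f) (fun z => lam * f z) (Metric.ball (0:ℂ) 1)) ↔
      (∃ m : ℕ, lam = 1 / ((m : ℂ) + 1))) ∧
    ((∃ f, MemDiscAlg f ∧ (∃ z ∈ Metric.ball (0:ℂ) 1, f z ≠ 0) ∧
        Set.EqOn (cesaro t f) (fun z => lam * f z) (Metric.ball (0:ℂ) 1)) ↔
      (∃ m : ℕ, lam = 1 / ((m : ℂ) + 1))) := by
  refine ⟨⟨fun ⟨f, hf, hne, heq⟩ => eigenvalue_eq_of_eqOn_cesaro ht0 ht1 hf.1 hne heq, ?_⟩,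
    ⟨fun ⟨f, hf, hne, heq⟩ => eigenvalue_eq_of_eqOn_cesaro ht0 ht1 hf.1 hne heq, ?_⟩⟩
  · rintro ⟨m, rfl⟩
    obtain ⟨f, hf, h⟩ := exists_memDiscAlg_eigenfunction ht0 ht1 m
    exact ⟨f, hf.memHinf, h⟩
  · rintro ⟨m, rfl⟩
    exact exists_memDiscAlg_eigenfunction ht0 ht1 m
end

section
/- Let t ∈ [0,1) and consider C_t acting on H^∞ (respectively on A(𝔻)). The kernel of I − C_t is the one-dimensional span of the function h_t(z) = 1/(1−tz), the range of I − C_t equals {g : g(0) = 0}, and consequently Ker(I − C_t) ∩ Im(I − C_t) = {0}. -/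
open Complex MeasureTheory Metric Set Filter Topology

lemma one_sub_real_mul_ne_zero {t : ℝ} (ht0 : 0 ≤ t) (ht1 : t < 1) {z : ℂ} (hz : ‖z‖ ≤ 1) :
    1 - (t : ℂ) * z ≠ 0 := by
  intro h
  have h1 : ‖(t : ℂ) * z‖ = 1 := by rw [← sub_eq_zero.mp h, norm_one]
  rw [norm_mul, norm_real, Real.norm_of_nonneg ht0] at h1
  nlinarith [norm_nonneg z]

lemma one_sub_le_norm_one_sub_real_mul {t : ℝ} (ht0 : 0 ≤ t) {z : ℂ} (hz : ‖z‖ ≤ 1) :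
    1 - t ≤ ‖1 - (t : ℂ) * z‖ := by
  have h := norm_sub_norm_le (1 : ℂ) ((t : ℂ) * z)
  rw [norm_one, norm_mul, norm_real, Real.norm_of_nonneg ht0] at h
  nlinarith

lemma ofReal_mul_mem_ball {s : ℝ} (hs : s ∈ Set.Icc (0 : ℝ) 1) {z : ℂ} (hz : z ∈ ball (0 : ℂ) 1) :
    (s : ℂ) * z ∈ ball (0 : ℂ) 1 := by
  rw [mem_ball_zero_iff] at hz ⊢
  rw [norm_mul, norm_real, Real.norm_of_nonneg hs.1]
  nlinarith [hs.2, norm_nonneg z]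

/-- Integration of a derivative along the segment from `0` to `z` inside the unit disc. -/
lemma mul_integral_segment_eq_sub {Φ φ : ℂ → ℂ}
    (hΦ : ∀ z ∈ ball (0 : ℂ) 1, HasDerivAt Φ (φ z) z) (hφ : ContinuousOn φ (ball (0 : ℂ) 1))
    {z : ℂ} (hz : z ∈ ball (0 : ℂ) 1) :
    z * ∫ s in (0 : ℝ)..1, φ ((s : ℂ) * z) = Φ z - Φ 0 := by
  have h := intervalIntegral.integral_unitInterval_deriv_eq_sub (𝕜 := ℂ) (f := Φ) (f' := φ)
    (z₀ := 0) (z₁ := z)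
    (by
      refine hφ.comp (by fun_prop) fun s hs => ?_
      simpa using ofReal_mul_mem_ball hs hz)
    (fun s hs => by
      simpa using hΦ _ (ofReal_mul_mem_ball hs hz))
  simpa using h

lemma cesaro_zero (t : ℝ) (f : ℂ → ℂ) : cesaro t f 0 = f 0 := by
  simp [cesaro]

/-- If `Φ` is a primitive of `f(z) / (1 - tz)` on the disc, then `z (C_t f)(z) = Φ z - Φ 0`. -/
lemma mul_cesaro_eq_sub {t : ℝ} (ht0 : 0 ≤ t) (ht1 : t < 1) {f Φ : ℂ → ℂ}
    (hf : ContinuousOn f (ball (0 : ℂ) 1))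
    (hΦ : ∀ z ∈ ball (0 : ℂ) 1, HasDerivAt Φ (f z / (1 - (t : ℂ) * z)) z)
    {z : ℂ} (hz : z ∈ ball (0 : ℂ) 1) : z * cesaro t f z = Φ z - Φ 0 := by
  rw [← mul_integral_segment_eq_sub hΦ _ hz]
  · unfold cesaro
    congr 2
    ext s
    ring
  · exact hf.div (by fun_prop) fun w hw =>
      one_sub_real_mul_ne_zero ht0 ht1 (mem_ball_zero_iff.mp hw).le

lemma eqOn_cesaro_of_hasDerivAt {t : ℝ} (ht0 : 0 ≤ t) (ht1 : t < 1) {f k : ℂ → ℂ}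
    (hf : ContinuousOn f (ball (0 : ℂ) 1)) (hk0 : k 0 = f 0)
    (hk : ∀ z ∈ ball (0 : ℂ) 1, HasDerivAt (fun w => w * k w) (f z / (1 - (t : ℂ) * z)) z) :
    EqOn (cesaro t f) k (ball (0 : ℂ) 1) := by
  intro z hz
  rcases eq_or_ne z 0 with rfl | hne
  · rw [cesaro_zero, hk0]
  · have h := mul_cesaro_eq_sub ht0 ht1 hf hk hz
    simp only [zero_mul, sub_zero] at h
    exact mul_left_cancel₀ hne h

lemma hasDerivAt_one_sub_mul (t z : ℂ) : HasDerivAt (fun w : ℂ => 1 - t * w) (-t) z := by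
  simpa using ((hasDerivAt_id z).const_mul t).const_sub 1

lemma eqOn_const_of_mul_deriv_eq_zero {w : ℂ → ℂ} (hw : DifferentiableOn ℂ w (ball (0 : ℂ) 1))
    (h : ∀ z ∈ ball (0 : ℂ) 1, z * deriv w z = 0) {z : ℂ} (hz : z ∈ ball (0 : ℂ) 1) :
    w z = w 0 := by
  have h0 : (0 : ℂ) ∈ ball (0 : ℂ) 1 := mem_ball_self one_pos
  refine isOpen_ball.is_const_of_deriv_eq_zero (convex_ball _ _).isPreconnected hw ?_ hz h0
  have hne : ∀ x ∈ ball (0 : ℂ) 1, x ≠ 0 → deriv w x = 0 := fun x hx hx0 =>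
    (mul_eq_zero.mp (h x hx)).resolve_left hx0
  intro x hx
  rcases eq_or_ne x 0 with rfl | hx0
  · have hc : ContinuousAt (deriv w) 0 :=
      (hw.deriv isOpen_ball).continuousOn.continuousAt (isOpen_ball.mem_nhds h0)
    refine tendsto_nhds_unique (hc.tendsto.mono_left (nhdsWithin_le_nhds (s := {0}ᶜ))) ?_
    refine tendsto_const_nhds.congr' ?_
    filter_upwards [mem_nhdsWithin_of_mem_nhds (isOpen_ball.mem_nhds h0), self_mem_nhdsWithin]
      with y hy hy0
    exact (hne y hy hy0).symm
  · exact hne x hx hx0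

/-- The kernel of `I - C_t` on holomorphic functions of the disc. -/
lemma eqOn_cesaro_self_iff {t : ℝ} (ht0 : 0 ≤ t) (ht1 : t < 1) {f : ℂ → ℂ}
    (hf : DifferentiableOn ℂ f (ball (0 : ℂ) 1)) :
    EqOn (cesaro t f) f (ball (0 : ℂ) 1) ↔
      ∃ c : ℂ, EqOn f (fun z => c / (1 - (t : ℂ) * z)) (ball (0 : ℂ) 1) := by
  have hne : ∀ z ∈ ball (0 : ℂ) 1, 1 - (t : ℂ) * z ≠ 0 := fun z hz =>
    one_sub_real_mul_ne_zero ht0 ht1 (mem_ball_zero_iff.mp hz).le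
  have hdat : ∀ z ∈ ball (0 : ℂ) 1, HasDerivAt f (deriv f z) z := fun z hz =>
    (hf.differentiableAt (isOpen_ball.mem_nhds hz)).hasDerivAt
  constructor
  · intro h
    obtain ⟨Φ, hΦ⟩ : IsExactOn (fun z => f z / (1 - (t : ℂ) * z)) (ball (0 : ℂ) 1) :=
      (hf.div (by fun_prop) hne).isExactOn_ball
    have hode : ∀ z ∈ ball (0 : ℂ) 1, f z + z * deriv f z = f z / (1 - (t : ℂ) * z) := by
      intro z hz
      have h1 : HasDerivAt (fun w => w * f w) (1 * f z + z * deriv f z) z :=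
        (hasDerivAt_id z).mul (hdat z hz)
      have h2 : HasDerivAt (fun w => w * f w) (f z / (1 - (t : ℂ) * z)) z := by
        refine ((hΦ z hz).sub_const (Φ 0)).congr_of_eventuallyEq ?_
        filter_upwards [isOpen_ball.mem_nhds hz] with w hw
        rw [← mul_cesaro_eq_sub ht0 ht1 hf.continuousOn hΦ hw, h hw]
      simpa using h1.unique h2
    have hw : ∀ z ∈ ball (0 : ℂ) 1, HasDerivAt (fun w => (1 - (t : ℂ) * w) * f w)
        (-(t : ℂ) * f z + (1 - (t : ℂ) * z) * deriv f z) z := fun z hz =>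
      (hasDerivAt_one_sub_mul _ z).mul (hdat z hz)
    refine ⟨f 0, fun z hz => ?_⟩
    have hconst := eqOn_const_of_mul_deriv_eq_zero
      (fun x hx => (hw x hx).differentiableAt.differentiableWithinAt)
      (fun x hx => by
        have h3 := hode x hx
        rw [eq_div_iff (hne x hx)] at h3
        rw [(hw x hx).deriv]
        linear_combination h3) hz
    simp only [mul_zero, sub_zero, one_mul] at hconst
    rw [eq_div_iff (hne z hz), ← hconst]
    ring
  · rintro ⟨c, hc⟩
    refine eqOn_cesaro_of_hasDerivAt ht0 ht1 hf.continuousOn rfl fun z hz => ?_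
    have h1 : HasDerivAt (fun w : ℂ => w * (c / (1 - (t : ℂ) * w)))
        (1 * (c / (1 - (t : ℂ) * z)) +
          z * ((0 * (1 - (t : ℂ) * z) - c * (-(t : ℂ))) / (1 - (t : ℂ) * z) ^ 2)) z :=
      (hasDerivAt_id z).mul ((hasDerivAt_const z c).div (hasDerivAt_one_sub_mul _ z) (hne z hz))
    refine (h1.congr_of_eventuallyEq ?_).congr_deriv ?_
    · filter_upwards [isOpen_ball.mem_nhds hz] with w hw
      rw [hc hw]
    · have := hne z hz
      rw [hc hz]
      field_simp
      ring

/-- The integral `∫_0^z (g(ξ) - g(0)) / ξ dξ` along the segment from `0` to `z`. -/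
noncomputable def slopeIntegral (g : ℂ → ℂ) (z : ℂ) : ℂ :=
  z * ∫ s in (0 : ℝ)..1, dslope g 0 ((s : ℂ) * z)

lemma hasDerivAt_slopeIntegral {g : ℂ → ℂ} (hg : DifferentiableOn ℂ g (ball (0 : ℂ) 1))
    {z : ℂ} (hz : z ∈ ball (0 : ℂ) 1) : HasDerivAt (slopeIntegral g) (dslope g 0 z) z := by
  have hq : DifferentiableOn ℂ (dslope g 0) (ball (0 : ℂ) 1) :=
    (differentiableOn_dslope (ball_mem_nhds 0 one_pos)).mpr hg
  obtain ⟨Φ, hΦ⟩ := hq.isExactOn_ball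
  refine ((hΦ z hz).sub_const (Φ 0)).congr_of_eventuallyEq ?_
  filter_upwards [isOpen_ball.mem_nhds hz] with w hw
  exact mul_integral_segment_eq_sub hΦ hq.continuousOn hw

/-- The solution `g + h_t ∫ g(ξ)/ξ dξ` of the equation `f - C_t f = g`, when `g 0 = 0`. -/
noncomputable def cesaroResolvent (t : ℝ) (g : ℂ → ℂ) (z : ℂ) : ℂ :=
  g z + slopeIntegral g z / (1 - (t : ℂ) * z)

lemma differentiableOn_cesaroResolvent {t : ℝ} (ht0 : 0 ≤ t) (ht1 : t < 1) {g : ℂ → ℂ}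
    (hg : DifferentiableOn ℂ g (ball (0 : ℂ) 1)) :
    DifferentiableOn ℂ (cesaroResolvent t g) (ball (0 : ℂ) 1) :=
  hg.add (DifferentiableOn.div
    (fun _ hz => (hasDerivAt_slopeIntegral hg hz).differentiableAt.differentiableWithinAt)
    (by fun_prop)
    fun _ hz => one_sub_real_mul_ne_zero ht0 ht1 (mem_ball_zero_iff.mp hz).le)

lemma cesaroResolvent_sub_cesaro {t : ℝ} (ht0 : 0 ≤ t) (ht1 : t < 1) {g : ℂ → ℂ}
    (hg : DifferentiableOn ℂ g (ball (0 : ℂ) 1)) (hg0 : g 0 = 0) :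
    EqOn (fun z => cesaroResolvent t g z - cesaro t (cesaroResolvent t g) z) g
      (ball (0 : ℂ) 1) := by
  have key : EqOn (cesaro t (cesaroResolvent t g))
      (fun z => slopeIntegral g z / (1 - (t : ℂ) * z)) (ball (0 : ℂ) 1) := by
    refine eqOn_cesaro_of_hasDerivAt ht0 ht1
      (differentiableOn_cesaroResolvent ht0 ht1 hg).continuousOn
      (by simp [cesaroResolvent, hg0]) fun z hz => ?_
    have hne : 1 - (t : ℂ) * z ≠ 0 :=
      one_sub_real_mul_ne_zero ht0 ht1 (mem_ball_zero_iff.mp hz).le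
    refine ((hasDerivAt_id z).mul ((hasDerivAt_slopeIntegral hg hz).div
      (hasDerivAt_one_sub_mul _ z) hne)).congr_deriv ?_
    have hgz : g z = z * dslope g 0 z := by
      have := sub_smul_dslope g 0 z
      simpa [hg0] using this.symm
    simp only [cesaroResolvent, hgz, id, Pi.div_apply]
    field_simp
    ring
  intro z hz
  simp only [key hz, cesaroResolvent, add_sub_cancel_right]

lemma memHinf_cesaroResolvent {t : ℝ} (ht0 : 0 ≤ t) (ht1 : t < 1) {g : ℂ → ℂ}
    (hg : MemHinf g) (hg0 : g 0 = 0) : MemHinf (cesaroResolvent t g) := by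
  refine ⟨differentiableOn_cesaroResolvent ht0 ht1 hg.1, ?_⟩
  obtain ⟨B, hB⟩ := hg.2
  have hgB : ∀ z ∈ ball (0 : ℂ) 1, ‖g z‖ ≤ B := fun z hz => hB ⟨z, hz, rfl⟩
  have hB0 : 0 ≤ B := (norm_nonneg _).trans (hgB 0 (mem_ball_self one_pos))
  have hq : ∀ z ∈ ball (0 : ℂ) 1, ‖dslope g 0 z‖ ≤ B := fun z hz => by
    have := norm_dslope_le_div_of_mapsTo_ball (R₂ := B) hg.1
      (fun w hw => by simpa [hg0] using hgB w hw) hz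
    simpa using this
  refine ⟨B + B / (1 - t), ?_⟩
  rintro _ ⟨z, hz, rfl⟩
  have hz1 : ‖z‖ ≤ 1 := (mem_ball_zero_iff.mp hz).le
  have hint : ‖∫ s in (0 : ℝ)..1, dslope g 0 ((s : ℂ) * z)‖ ≤ B := by
    have := intervalIntegral.norm_integral_le_of_norm_le_const (a := (0 : ℝ)) (b := 1) (C := B)
      (f := fun s : ℝ => dslope g 0 ((s : ℂ) * z)) fun s hs => by
        rw [uIoc_of_le zero_le_one] at hs
        exact hq _ (ofReal_mul_mem_ball ⟨hs.1.le, hs.2⟩ hz)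
    simpa using this
  have hu : ‖slopeIntegral g z‖ ≤ B := by
    rw [slopeIntegral, norm_mul]
    exact (mul_le_of_le_one_left (norm_nonneg _) hz1).trans hint
  refine (norm_add_le _ _).trans (add_le_add (hgB z hz) ?_)
  rw [norm_div]
  exact div_le_div₀ hB0 hu (sub_pos.mpr ht1) (one_sub_le_norm_one_sub_real_mul ht0 hz1)

lemma continuousOn_slopeIntegral {g : ℂ → ℂ} (hg : MemDiscAlg g) :
    ContinuousOn (slopeIntegral g) (closedBall (0 : ℂ) 1) := by
  have hq : ContinuousOn (dslope g 0) (closedBall (0 : ℂ) 1) :=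
    (continuousOn_dslope (closedBall_mem_nhds 0 one_pos)).mpr
      ⟨hg.2, hg.1.differentiableAt (ball_mem_nhds 0 one_pos)⟩
  refine continuousOn_id.mul ?_
  rw [continuousOn_iff_continuous_domRestrict]
  have hc : Continuous fun z : closedBall (0 : ℂ) 1 => ∫ s in (0 : ℝ)..1,
      dslope g 0 (((projIcc (0 : ℝ) 1 zero_le_one s : ℝ) : ℂ) * (z : ℂ)) := by
    refine intervalIntegral.continuous_parametric_intervalIntegral_of_continuous' ?_ 0 1
    refine hq.comp_continuous (f := fun p : closedBall (0 : ℂ) 1 × ℝ =>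
      ((projIcc (0 : ℝ) 1 zero_le_one p.2 : ℝ) : ℂ) * (p.1 : ℂ)) ?_ ?_
    · have := continuous_projIcc (a := (0 : ℝ)) (b := 1) (h := zero_le_one)
      fun_prop
    · rintro ⟨z, s⟩
      have hs := (projIcc (0 : ℝ) 1 zero_le_one s).2
      have hz := mem_closedBall_zero_iff.mp z.2
      rw [mem_closedBall_zero_iff, norm_mul, norm_real, Real.norm_of_nonneg hs.1]
      exact mul_le_one₀ hs.2 (norm_nonneg _) hz
  refine hc.congr fun z => intervalIntegral.integral_congr fun s hs => ?_
  rw [uIcc_of_le zero_le_one] at hs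
  simp only [projIcc_of_mem zero_le_one hs]

lemma memDiscAlg_cesaroResolvent {t : ℝ} (ht0 : 0 ≤ t) (ht1 : t < 1) {g : ℂ → ℂ}
    (hg : MemDiscAlg g) : MemDiscAlg (cesaroResolvent t g) :=
  ⟨differentiableOn_cesaroResolvent ht0 ht1 hg.1,
    hg.2.add ((continuousOn_slopeIntegral hg).div (by fun_prop) fun _ hz =>
      one_sub_real_mul_ne_zero ht0 ht1 (mem_closedBall_zero_iff.mp hz))⟩

lemma eq_zero_of_eqOn_sub_cesaro {t : ℝ} {f g : ℂ → ℂ}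
    (h : EqOn (fun z => f z - cesaro t f z) g (ball (0 : ℂ) 1)) : g 0 = 0 := by
  rw [← h (mem_ball_self one_pos)]
  simp [cesaro_zero]

lemma eqOn_zero_of_eqOn_cesaro_self {t : ℝ} (ht0 : 0 ≤ t) (ht1 : t < 1) {u : ℂ → ℂ}
    (hu : DifferentiableOn ℂ u (ball (0 : ℂ) 1)) (hker : EqOn (cesaro t u) u (ball (0 : ℂ) 1))
    (hu0 : u 0 = 0) : EqOn u 0 (ball (0 : ℂ) 1) := by
  obtain ⟨c, hc⟩ := (eqOn_cesaro_self_iff ht0 ht1 hu).mp hker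
  have hc0 : c = 0 := by simpa [hu0] using (hc (mem_ball_self one_pos)).symm
  intro z hz
  simp [hc hz, hc0]

/-- For each `t ∈ [0,1)` and for `X = H^∞` (resp. `X = A(𝔻)`): the kernel of
`I - C_t` is the span of `h_t(z) = 1/(1-tz)`, the range of `I - C_t` is
`{g ∈ X : g 0 = 0}`, and consequently `Ker(I - C_t) ∩ Im(I - C_t) = {0}`. -/
theorem cesaro_kernel_range_I_sub (t : ℝ) (ht0 : 0 ≤ t) (ht1 : t < 1) :
    ((∀ f, MemHinf f →
        (Set.EqOn (cesaro t f) f (Metric.ball (0:ℂ) 1) ↔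
          ∃ c : ℂ, Set.EqOn f (fun z => c / (1 - (t : ℂ) * z)) (Metric.ball (0:ℂ) 1))) ∧
      (∀ g, MemHinf g →
        ((∃ f, MemHinf f ∧
            Set.EqOn (fun z => f z - cesaro t f z) g (Metric.ball (0:ℂ) 1)) ↔ g 0 = 0)) ∧
      (∀ u, MemHinf u → Set.EqOn (cesaro t u) u (Metric.ball (0:ℂ) 1) →
        (∃ f, MemHinf f ∧
          Set.EqOn (fun z => f z - cesaro t f z) u (Metric.ball (0:ℂ) 1)) →
        Set.EqOn u 0 (Metric.ball (0:ℂ) 1))) ∧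
    ((∀ f, MemDiscAlg f →
        (Set.EqOn (cesaro t f) f (Metric.ball (0:ℂ) 1) ↔
          ∃ c : ℂ, Set.EqOn f (fun z => c / (1 - (t : ℂ) * z)) (Metric.ball (0:ℂ) 1))) ∧
      (∀ g, MemDiscAlg g →
        ((∃ f, MemDiscAlg f ∧
            Set.EqOn (fun z => f z - cesaro t f z) g (Metric.ball (0:ℂ) 1)) ↔ g 0 = 0)) ∧
      (∀ u, MemDiscAlg u → Set.EqOn (cesaro t u) u (Metric.ball (0:ℂ) 1) →
        (∃ f, MemDiscAlg f ∧
          Set.EqOn (fun z => f z - cesaro t f z) u (Metric.ball (0:ℂ) 1)) →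
        Set.EqOn u 0 (Metric.ball (0:ℂ) 1))) := by
  refine ⟨⟨fun f hf => eqOn_cesaro_self_iff ht0 ht1 hf.1, fun g hg => ⟨?_, fun hg0 => ?_⟩, ?_⟩,
    fun f hf => eqOn_cesaro_self_iff ht0 ht1 hf.1, fun g hg => ⟨?_, fun hg0 => ?_⟩, ?_⟩
  · rintro ⟨f, -, h⟩
    exact eq_zero_of_eqOn_sub_cesaro h
  · exact ⟨_, memHinf_cesaroResolvent ht0 ht1 hg hg0, cesaroResolvent_sub_cesaro ht0 ht1 hg.1 hg0⟩
  · rintro u hu hker ⟨f, -, h⟩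
    exact eqOn_zero_of_eqOn_cesaro_self ht0 ht1 hu.1 hker (eq_zero_of_eqOn_sub_cesaro h)
  · rintro ⟨f, -, h⟩
    exact eq_zero_of_eqOn_sub_cesaro h
  · exact ⟨_, memDiscAlg_cesaroResolvent ht0 ht1 hg, cesaroResolvent_sub_cesaro ht0 ht1 hg.1 hg0⟩
  · rintro u hu hker ⟨f, -, h⟩
    exact eqOn_zero_of_eqOn_cesaro_self ht0 ht1 hu.1 hker (eq_zero_of_eqOn_sub_cesaro h)
end

section
/- For every t ∈ (0,1), the generalized Cesàro operator C_t on the Hardy space H^1 satisfies the norm estimate ‖C_t f‖_1 ≤ ((−log(1−t))/t)·‖f‖_1 for all f ∈ H^1; in particular ‖C_t‖_{H^1→H^1} ≤ (−log(1−t))/t. -/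
open Complex MeasureTheory Metric Set Filter Topology

/-- The integral means `M_p(r, f)`. -/
noncomputable def Mp (p : ℝ) (r : ℝ) (f : ℂ → ℂ) : ℝ :=
  ((1 / (2 * Real.pi)) *
    ∫ θ in (0:ℝ)..(2 * Real.pi), ‖f ((r : ℂ) * Complex.exp ((θ : ℂ) * Complex.I))‖ ^ p) ^ (1 / p)

/-- The Hardy space norm `‖f‖_p = sup_{0 ≤ r < 1} M_p(r, f)`. -/
noncomputable def hardyNorm (p : ℝ) (f : ℂ → ℂ) : ℝ :=
  sSup ((fun r => Mp p r f) '' Set.Ico (0:ℝ) 1)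

/-- Membership in the Hardy space `H^p`: holomorphic on the unit disc with bounded
integral means. -/
def MemHp (p : ℝ) (f : ℂ → ℂ) : Prop :=
  DifferentiableOn ℂ f (Metric.ball (0:ℂ) 1) ∧
    BddAbove ((fun r => Mp p r f) '' Set.Ico (0:ℝ) 1)

lemma Mp_one (r : ℝ) (f : ℂ → ℂ) :
    Mp 1 r f = 1 / (2 * Real.pi) *
      ∫ θ in (0:ℝ)..(2 * Real.pi), ‖f ((r : ℂ) * exp ((θ : ℂ) * I))‖ := by
  simp [Mp]

lemma one_sub_ofReal_mul_ne_zero {t : ℝ} (ht0 : 0 ≤ t) (ht1 : t ≤ 1) {w : ℂ}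
    (hw : w ∈ ball (0:ℂ) 1) : 1 - (t : ℂ) * w ≠ 0 := by
  intro h
  have h1 : (t : ℂ) * w = 1 := (sub_eq_zero.mp h).symm
  have h2 : t * ‖w‖ = 1 := by
    simpa [abs_of_nonneg ht0] using congrArg norm h1
  have h3 : ‖w‖ < 1 := by simpa using hw
  nlinarith [norm_nonneg w]

lemma ofReal_mul_mem_unit_ball {s : ℝ} (hs : s ∈ Icc (0:ℝ) 1) {z : ℂ}
    (hz : z ∈ ball (0:ℂ) 1) : (s : ℂ) * z ∈ ball (0:ℂ) 1 := by
  have h3 : ‖z‖ < 1 := by simpa using hz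
  simp only [mem_ball_zero_iff, norm_mul, norm_real, Real.norm_eq_abs, abs_of_nonneg hs.1]
  nlinarith [hs.1, hs.2, norm_nonneg z]

lemma ofReal_mul_exp_mem_unit_ball {r : ℝ} (hr : r ∈ Ico (0:ℝ) 1) (θ : ℝ) :
    (r : ℂ) * exp ((θ : ℂ) * I) ∈ ball (0:ℂ) 1 := by
  simpa [norm_exp_ofReal_mul_I, abs_of_nonneg hr.1] using hr.2

/-- The Cesàro transform of a holomorphic function is the difference quotient at the origin of a
primitive of `f(w) / (1 - t w)`, hence holomorphic. -/
lemma differentiableOn_cesaro {t : ℝ} (ht0 : 0 ≤ t) (ht1 : t ≤ 1) {f : ℂ → ℂ}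
    (hf : DifferentiableOn ℂ f (ball (0:ℂ) 1)) :
    DifferentiableOn ℂ (cesaro t f) (ball (0:ℂ) 1) := by
  have hg : DifferentiableOn ℂ (fun w : ℂ => f w / (1 - (t : ℂ) * w)) (ball (0:ℂ) 1) :=
    hf.div (by fun_prop) fun w hw => one_sub_ofReal_mul_ne_zero ht0 ht1 hw
  obtain ⟨F, hF⟩ := hg.isExactOn_ball
  have hFd : DifferentiableOn ℂ F (ball (0:ℂ) 1) :=
    fun w hw => (hF w hw).differentiableAt.differentiableWithinAt
  refine ((differentiableOn_dslope (ball_mem_nhds (0:ℂ) one_pos)).2 hFd).congr fun z hz => ?_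
  rcases eq_or_ne z 0 with rfl | hz0
  · rw [dslope_same, (hF 0 hz).deriv]
    simp [cesaro]
  · have key : ∫ s in (0:ℝ)..1, f ((s : ℂ) * z) / (1 - (t : ℂ) * ((s : ℂ) * z)) * z
        = F (((1:ℝ) : ℂ) * z) - F (((0:ℝ) : ℂ) * z) := by
      have hmem : ∀ s ∈ uIcc (0:ℝ) 1, (s : ℂ) * z ∈ ball (0:ℂ) 1 := fun s hs =>
        ofReal_mul_mem_unit_ball (by rwa [uIcc_of_le zero_le_one] at hs) hz
      refine intervalIntegral.integral_eq_sub_of_hasDerivAt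
        (f := fun s : ℝ => F ((s : ℂ) * z)) (fun s hs => ?_) ?_
      · have h1 : HasDerivAt (fun s : ℝ => (s : ℂ) * z) z s := by
          simpa using (hasDerivAt_id s).ofReal_comp.mul_const z
        exact (hF _ (hmem s hs)).comp s h1
      · refine ContinuousOn.intervalIntegrable ?_
        have : ContinuousOn (fun s : ℝ => (s : ℂ) * z) (uIcc (0:ℝ) 1) := by fun_prop
        exact (hg.continuousOn.comp this hmem).mul continuousOn_const
    rw [intervalIntegral.integral_mul_const] at key
    rw [dslope_of_ne _ hz0, slope_def_field, sub_zero, eq_div_iff hz0]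
    simp only [ofReal_one, one_mul, ofReal_zero, zero_mul] at key
    rw [← key, cesaro]
    congr 1
    refine intervalIntegral.integral_congr fun s _ => ?_
    ring_nf

lemma integral_one_div_one_sub_mul {t : ℝ} (ht0 : 0 < t) (ht1 : t < 1) :
    ∫ s in (0:ℝ)..1, 1 / (1 - s * t) = -Real.log (1 - t) / t := by
  have hpos : ∀ s ∈ uIcc (0:ℝ) 1, 1 - s * t ≠ 0 := fun s hs => by
    rw [uIcc_of_le zero_le_one] at hs
    nlinarith [hs.1, hs.2]
  have hderiv : ∀ s ∈ uIcc (0:ℝ) 1,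
      HasDerivAt (fun s : ℝ => -Real.log (1 - s * t) / t) (1 / (1 - s * t)) s := fun s hs => by
    have h1 : HasDerivAt (fun s : ℝ => 1 - s * t) (-t) s := by
      simpa using ((hasDerivAt_id s).mul_const t).const_sub 1
    have hne := hpos s hs
    refine ((h1.log hne).neg.div_const t).congr_deriv ?_
    field_simp
  rw [intervalIntegral.integral_eq_sub_of_hasDerivAt hderiv
    (ContinuousOn.intervalIntegrable (ContinuousOn.div continuousOn_const (by fun_prop) hpos))]
  simp

lemma norm_cesaro_le_s10 {t : ℝ} (ht0 : 0 ≤ t) (ht1 : t < 1) {f : ℂ → ℂ}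
    (hf : ContinuousOn f (ball (0:ℂ) 1)) {z : ℂ} (hz : z ∈ ball (0:ℂ) 1) :
    ‖cesaro t f z‖ ≤ ∫ s in (0:ℝ)..1, ‖f ((s : ℂ) * z)‖ * (1 / (1 - s * t)) := by
  refine intervalIntegral.norm_integral_le_of_norm_le zero_le_one
    (Filter.Eventually.of_forall fun s hs => ?_) ?_
  · have hs' : s ∈ Icc (0:ℝ) 1 := Ioc_subset_Icc_self hs
    have hz1 : ‖z‖ < 1 := by simpa using hz
    have hst : 0 ≤ s * t := mul_nonneg hs'.1 ht0
    have hpos : 0 < 1 - s * t := by nlinarith [hs'.1, hs'.2]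
    rw [norm_div, div_eq_mul_one_div]
    gcongr
    calc 1 - s * t ≤ 1 - s * t * ‖z‖ := by nlinarith
      _ = ‖(1:ℂ)‖ - ‖(s : ℂ) * (t : ℂ) * z‖ := by
        simp [abs_of_nonneg hs'.1, abs_of_nonneg ht0]
      _ ≤ _ := norm_sub_norm_le _ _
  · refine ContinuousOn.intervalIntegrable (ContinuousOn.mul ?_ ?_)
    · have : ContinuousOn (fun s : ℝ => (s : ℂ) * z) (uIcc (0:ℝ) 1) := by fun_prop
      exact (hf.comp this fun s hs =>
        ofReal_mul_mem_unit_ball (by rwa [uIcc_of_le zero_le_one] at hs) hz).norm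
    · refine continuousOn_const.div (by fun_prop) fun s hs => ?_
      rw [uIcc_of_le zero_le_one] at hs
      nlinarith [hs.1, hs.2]

/-- A uniform bound on the integral means of `f` yields one for those of `cesaro t f`. -/
lemma Mp_one_cesaro_le {t : ℝ} (ht0 : 0 < t) (ht1 : t < 1) {f : ℂ → ℂ}
    (hf : DifferentiableOn ℂ f (ball (0:ℂ) 1)) {N : ℝ}
    (hN : ∀ r ∈ Ico (0:ℝ) 1, Mp 1 r f ≤ N) {r : ℝ} (hr : r ∈ Ico (0:ℝ) 1) :
    Mp 1 r (cesaro t f) ≤ -Real.log (1 - t) / t * N := by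
  have hpi : (0:ℝ) ≤ 2 * Real.pi := Real.two_pi_pos.le
  have hden : ∀ s ∈ Icc (0:ℝ) 1, 0 < 1 - s * t := fun s hs => by nlinarith [hs.1, hs.2]
  have hcirc : Continuous fun θ : ℝ => (r : ℂ) * exp ((θ : ℂ) * I) := by fun_prop
  have hdenc : ContinuousOn (fun s : ℝ => 1 / (1 - s * t)) (Icc 0 1) :=
    continuousOn_const.div (by fun_prop) fun s hs => (hden s hs).ne'
  set G : ℝ → ℝ → ℝ := fun θ s =>
    ‖f ((s : ℂ) * ((r : ℂ) * exp ((θ : ℂ) * I)))‖ * (1 / (1 - s * t)) with hG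
  have hGc : ContinuousOn (Function.uncurry G) (Icc 0 (2 * Real.pi) ×ˢ Icc 0 1) := by
    refine ContinuousOn.mul (ContinuousOn.norm (hf.continuousOn.comp
      (f := fun p : ℝ × ℝ => (p.2 : ℂ) * ((r : ℂ) * exp ((p.1 : ℂ) * I))) ?_ ?_)) ?_
    · fun_prop
    · exact fun p hp => ofReal_mul_mem_unit_ball hp.2 (ofReal_mul_exp_mem_unit_ball hr _)
    · exact hdenc.comp continuousOn_snd fun p hp => hp.2
  have hGi : IntegrableOn (Function.uncurry G) (Ioc 0 (2 * Real.pi) ×ˢ Ioc 0 1) :=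
    (hGc.integrableOn_compact (isCompact_Icc.prod isCompact_Icc)).mono_set
      (prod_mono Ioc_subset_Icc_self Ioc_subset_Icc_self)
  have hGi' : Integrable (Function.uncurry G)
      ((volume.restrict (Ioc 0 (2 * Real.pi))).prod (volume.restrict (Ioc 0 1))) := by
    rwa [Measure.prod_restrict]
  have hdom : ∫ θ in (0:ℝ)..(2 * Real.pi), ‖cesaro t f ((r : ℂ) * exp ((θ : ℂ) * I))‖
      ≤ ∫ θ in (0:ℝ)..(2 * Real.pi), ∫ s in (0:ℝ)..1, G θ s := by
    refine intervalIntegral.integral_mono_on hpi ?_ ?_ fun θ _ =>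
      norm_cesaro_le_s10 ht0.le ht1 hf.continuousOn (ofReal_mul_exp_mem_unit_ball hr θ)
    · exact Continuous.intervalIntegrable ((differentiableOn_cesaro ht0.le ht1.le
        hf).continuousOn.comp_continuous hcirc (ofReal_mul_exp_mem_unit_ball hr)).norm _ _
    · rw [intervalIntegrable_iff_integrableOn_Ioc_of_le hpi]
      simp only [intervalIntegral.integral_of_le zero_le_one]
      exact hGi'.integral_prod_left
  have hswap : ∫ θ in (0:ℝ)..(2 * Real.pi), ∫ s in (0:ℝ)..1, G θ s
      = ∫ s in (0:ℝ)..1, ∫ θ in (0:ℝ)..(2 * Real.pi), G θ s :=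
    intervalIntegral_intervalIntegral_swap (by rwa [uIoc_of_le hpi, uIoc_of_le zero_le_one])
  have hmean : ∫ s in (0:ℝ)..1, ∫ θ in (0:ℝ)..(2 * Real.pi), G θ s
      ≤ ∫ s in (0:ℝ)..1, 2 * Real.pi * N * (1 / (1 - s * t)) := by
    refine intervalIntegral.integral_mono_on zero_le_one ?_ ?_ fun s hs => ?_
    · rw [intervalIntegrable_iff_integrableOn_Ioc_of_le zero_le_one]
      simp only [intervalIntegral.integral_of_le hpi]
      exact hGi'.integral_prod_right
    · refine ContinuousOn.intervalIntegrable ?_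
      rw [uIcc_of_le zero_le_one]
      exact continuousOn_const.mul hdenc
    · have hsr : s * r ∈ Ico (0:ℝ) 1 :=
        ⟨mul_nonneg hs.1 hr.1, by nlinarith [hs.1, hs.2, hr.1, hr.2]⟩
      have h := hN _ hsr
      rw [Mp_one, one_div, inv_mul_le_iff₀ Real.two_pi_pos] at h
      simp only [hG, intervalIntegral.integral_mul_const]
      refine mul_le_mul_of_nonneg_right ?_ (one_div_nonneg.2 (hden s hs).le)
      simpa only [ofReal_mul, mul_assoc] using h
  rw [intervalIntegral.integral_const_mul, integral_one_div_one_sub_mul ht0 ht1] at hmean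
  rw [Mp_one, one_div, inv_mul_le_iff₀ Real.two_pi_pos]
  linarith [hdom.trans (hswap.le.trans hmean)]

/-- For each `t ∈ (0,1)`, the operator `C_t` on `H^1` satisfies
`‖C_t f‖_1 ≤ ((-log(1-t))/t) ‖f‖_1` for all `f ∈ H^1`. -/
theorem cesaro_H1_norm_estimate (t : ℝ) (ht0 : 0 < t) (ht1 : t < 1) :
    ∀ f, MemHp 1 f →
      MemHp 1 (cesaro t f) ∧
      hardyNorm 1 (cesaro t f) ≤ (-Real.log (1 - t) / t) * hardyNorm 1 f := by
  intro f hf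
  have hle : ∀ r ∈ Ico (0:ℝ) 1,
      Mp 1 r (cesaro t f) ≤ -Real.log (1 - t) / t * hardyNorm 1 f := fun r hr =>
    Mp_one_cesaro_le ht0 ht1 hf.1 (fun _ hρ => le_csSup hf.2 (mem_image_of_mem _ hρ)) hr
  refine ⟨⟨differentiableOn_cesaro ht0.le ht1.le hf.1, _, forall_mem_image.2 hle⟩, ?_⟩
  exact csSup_le ((nonempty_Ico.2 one_pos).image _) (forall_mem_image.2 hle)
end
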